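/- Let A be a unital dg-algebra over a field k with unit 1, and let n ≥ 3. Suppose given multilinear maps {m_k}_{k<n} on H_*(A) and {f_k}_{k<n} into A with m_1 = 0, m_2 the induced multiplication (so m_2(1,a) = m_2(a,1) = a where 1 also denotes the unit class of H_*(A)), f_1 cycle-choosing with f_1(1) = 1, and such that for all 2 ≤ k ≤ n−1 the map f_k vanishes whenever one of its arguments is a scalar multiple of the unit class, and for all 3 ≤ k ≤ n−1 the map m_k vanishes whenever one of its arguments is a scalar multiple of the unit class. Then Ψ_n(a_1,…,a_n) = 0 whenever some argument a_i is a scalar multiple λ·1 of the unit class. -/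

import Mathlib

/-!
Cycle-level encoding of `A_∞`-structures on the homology of a differential graded
algebra, following Kadeishvili.

A dg-algebra is presented as a `k`-algebra `A` with a grading `𝒜 : ℤ → Submodule k A`
(a graded monoid giving a direct sum decomposition) and a degree `+1` square-zero
differential `d` satisfying the graded Leibniz rule.

Elements of the homology `H = ker d / im d` are encoded by representing cycles.
A family of multilinear maps `(g_n : H^{⊗n} → A)_n` (resp. with values in `H`) is
encoded by a single function `F : List A → A` (the arity being the list length),
evaluated on lists of representing cycles; that `F` genuinely comes from a family
of multilinear maps on homology is expressed by the predicates below.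
-/

open LinearMap

/-- The integer sign `(-1) ^ e` associated to an integer exponent `e`. -/
def gsign (e : ℤ) : ℤ := if Even e then 1 else -1

variable {k A : Type*} [Field k] [Ring A] [Algebra k A]

/-- `(𝒜, d)` make the `k`-algebra `A` into a differential graded algebra. -/
structure IsDGAlgebra (𝒜 : ℤ → Submodule k A) (d : A →ₗ[k] A) : Prop where
  d_sq : ∀ x : A, d (d x) = 0
  d_deg : ∀ (i : ℤ), ∀ x ∈ 𝒜 i, d x ∈ 𝒜 (i + 1)
  leibniz : ∀ (i : ℤ), ∀ x ∈ 𝒜 i, ∀ y : A, d (x * y) = d x * y + gsign i • (x * d y)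

/-- Every member of `a` is a cycle. -/
def IsCycleList (d : A →ₗ[k] A) (a : List A) : Prop :=
  ∀ x ∈ a, x ∈ LinearMap.ker d

/-- `a` and `b` are entrywise homologous lists of cycles. -/
def HomologyEquiv (d : A →ₗ[k] A) (a b : List A) : Prop :=
  List.Forall₂
    (fun x y => x ∈ LinearMap.ker d ∧ y ∈ LinearMap.ker d ∧ x - y ∈ LinearMap.range d) a b

/-- `a` is a list of homogeneous elements whose degrees are listed in `ds`. -/
def IsHomogeneousList (𝒜 : ℤ → Submodule k A) (ds : List ℤ) (a : List A) : Prop :=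
  List.Forall₂ (fun x i => x ∈ 𝒜 i) a ds

/-- `F : List A → A` encodes, at every arity `≤ N`, a `k`-multilinear map on homology
classes (evaluated on lists of representing cycles) with values in `A`. -/
structure EncodesFamily (d : A →ₗ[k] A) (F : List A → A) (N : ℕ) : Prop where
  congr : ∀ a b : List A, a.length ≤ N → HomologyEquiv d a b → F a = F b
  map_add : ∀ (pre : List A) (u v : A) (post : List A),
    pre.length + post.length + 1 ≤ N → IsCycleList d pre →
    u ∈ LinearMap.ker d → v ∈ LinearMap.ker d → IsCycleList d post →
    F (pre ++ (u + v) :: post) = F (pre ++ u :: post) + F (pre ++ v :: post)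
  map_smul : ∀ (pre : List A) (c : k) (u : A) (post : List A),
    pre.length + post.length + 1 ≤ N → IsCycleList d pre →
    u ∈ LinearMap.ker d → IsCycleList d post →
    F (pre ++ (c • u) :: post) = c • F (pre ++ u :: post)

/-- `M : List A → A` encodes, at every arity `≤ N`, a `k`-multilinear operation on
homology with values in homology: the value on representing cycles is a (canonically
chosen) representing cycle of the resulting class. -/
structure EncodesOps (d : A →ₗ[k] A) (M : List A → A) (N : ℕ)
    extends EncodesFamily d M N : Prop where
  mem_ker : ∀ a : List A, a.length ≤ N → IsCycleList d a → M a ∈ LinearMap.ker d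

/-- At arity one, `F` encodes a cycle-choosing map `f₁ : H → A`: it sends (the class
of) a cycle `u` to a cycle homologous to `u`. -/
structure IsCycleChoosing (d : A →ₗ[k] A) (F : List A → A) : Prop where
  mem_ker : ∀ u ∈ LinearMap.ker d, F [u] ∈ LinearMap.ker d
  sub_mem : ∀ u ∈ LinearMap.ker d, F [u] - u ∈ LinearMap.range d

/-- The operations `mₙ` encoded by `M` have degree `2 - n`, for `n ≤ N`. -/
def OpsHaveDegree (𝒜 : ℤ → Submodule k A) (M : List A → A) (N : ℕ) : Prop :=
  ∀ (ds : List ℤ) (a : List A), a.length ≤ N → IsHomogeneousList 𝒜 ds a →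
    M a ∈ 𝒜 (ds.sum + 2 - a.length)

/-- The maps `fₙ` encoded by `F` have degree `1 - n`, for `n ≤ N`. -/
def MapsHaveDegree (𝒜 : ℤ → Submodule k A) (F : List A → A) (N : ℕ) : Prop :=
  ∀ (ds : List ℤ) (a : List A), a.length ≤ N → IsHomogeneousList 𝒜 ds a →
    F a ∈ 𝒜 (ds.sum + 1 - a.length)

/-- `m₁ = 0` on homology: the value of `M` at arity one represents the zero class. -/
def MOneZero (d : A →ₗ[k] A) (M : List A → A) : Prop :=
  ∀ u ∈ LinearMap.ker d, M [u] ∈ LinearMap.range d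

/-- `m₂` is the multiplication induced on homology by the product of `A`. -/
def MTwoInduced (d : A →ₗ[k] A) (M : List A → A) : Prop :=
  ∀ u ∈ LinearMap.ker d, ∀ v ∈ LinearMap.ker d, M [u, v] - u * v ∈ LinearMap.range d

/-- Kadeishvili's obstruction
`Ψₙ(a₁,…,aₙ) = ∑_{s=1}^{n-1} (-1)^{ε₁(s)} f_s(a₁,…,a_s)·f_{n-s}(a_{s+1},…,aₙ)
  + ∑_{j=2}^{n-1} ∑_{t=0}^{n-j} (-1)^{ε₂(t,j)} f_{n-j+1}(a₁,…,a_t, m_j(a_{t+1},…,a_{t+j}),…,aₙ)`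
with `ε₁(s) = s + (n-s+1)(|a₁|+⋯+|a_s|)` and `ε₂(t,j) = t + j(n-t-j+|a₁|+⋯+|a_t|)`,
evaluated on a list `a` of representing cycles with degree list `ds`; `n = a.length`. -/
def Psi (F M : List A → A) (ds : List ℤ) (a : List A) : A :=
  (∑ s ∈ Finset.Ioo 0 a.length,
      gsign ((s : ℤ) + ((a.length : ℤ) - (s : ℤ) + 1) * (ds.take s).sum) •
        (F (a.take s) * F (a.drop s))) +
  ∑ j ∈ Finset.Icc 2 (a.length - 1), ∑ t ∈ Finset.Icc 0 (a.length - j),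
      gsign ((t : ℤ) + (j : ℤ) * ((a.length : ℤ) - (t : ℤ) - (j : ℤ) + (ds.take t).sum)) •
        F (a.take t ++ M ((a.drop t).take j) :: a.drop (t + j))

/-- The Stasheff sum `∑_{r+s+t=n} (-1)^{r+st} m_{r+1+t}(1^{⊗r} ⊗ m_s ⊗ 1^{⊗t})`,
evaluated (with the Koszul sign `(-1)^{s(|a₁|+⋯+|a_r|)}`) on a list `a` of
representing cycles with degree list `ds`. -/
def StasheffSum (M : List A → A) (ds : List ℤ) (a : List A) : A :=
  ∑ r ∈ Finset.range a.length, ∑ s ∈ Finset.Icc 1 (a.length - r),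
    gsign ((r : ℤ) + (s : ℤ) * ((a.length : ℤ) - (r : ℤ) - (s : ℤ)) +
        (s : ℤ) * (ds.take r).sum) •
      M (a.take r ++ M ((a.drop r).take s) :: a.drop (r + s))

/-- The Stasheff identity `Stₙ` holds on homology at every arity `n ≤ N`. -/
def SatisfiesStasheff (d : A →ₗ[k] A) (𝒜 : ℤ → Submodule k A) (M : List A → A)
    (N : ℕ) : Prop :=
  ∀ (ds : List ℤ) (a : List A), a.length ≤ N → IsCycleList d a →
    IsHomogeneousList 𝒜 ds a → StasheffSum M ds a ∈ LinearMap.range d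

/-- The `A_∞`-operations of the dg-algebra `A` itself: `m₁ = d`, `m₂` the product,
and `mₙ = 0` for `n ≥ 3`. -/
def dgOps (d : A →ₗ[k] A) : List A → A
  | [x] => d x
  | [x, y] => x * y
  | _ => 0

/-- The exponent `w = (q-1)(i₁-1) + (q-2)(i₂-1) + ⋯ + (i_{q-1}-1)` attached to a
composition with blocks `bs = [i₁, …, i_q]`. -/
def wExp (bs : List ℕ) : ℤ :=
  ∑ p ∈ Finset.range bs.length,
    ((bs.length : ℤ) - 1 - (p : ℤ)) * ((bs.getD p 0 : ℤ) - 1)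

/-- The Koszul sign exponent arising when evaluating `f_{i₁} ⊗ ⋯ ⊗ f_{i_q}` on
homogeneous elements whose degrees are grouped into blocks `dbs`:
`∑_p (1 - i_p)·(sum of the degrees in the blocks before block p)`. -/
def koszulExp (dbs : List (List ℤ)) : ℤ :=
  ∑ p ∈ Finset.range dbs.length,
    (1 - ((dbs.getD p []).length : ℤ)) * ((dbs.take p).map List.sum).sum

/-- Left-hand side `∑_{r+s+t=n} (-1)^{r+st} f_{r+1+t}(1^{⊗r} ⊗ m_s ⊗ 1^{⊗t})` of the
Stasheff morphism identity `Stᵐₙ`, with Koszul signs, on representing cycles. -/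
def MorphismLHS (F M : List A → A) (ds : List ℤ) (a : List A) : A :=
  ∑ r ∈ Finset.range a.length, ∑ s ∈ Finset.Icc 1 (a.length - r),
    gsign ((r : ℤ) + (s : ℤ) * ((a.length : ℤ) - (r : ℤ) - (s : ℤ)) +
        (s : ℤ) * (ds.take r).sum) •
      F (a.take r ++ M ((a.drop r).take s) :: a.drop (r + s))

/-- Right-hand side `∑_{i₁+⋯+i_q=n} (-1)^w m_q(f_{i₁} ⊗ ⋯ ⊗ f_{i_q})` of the Stasheff
morphism identity `Stᵐₙ`, with Koszul signs; here the `m_q` are the dg-operations of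
the target `A` (`m₁ = d`, `m₂` the product, `mₙ = 0` otherwise). -/
def MorphismRHS (d : A →ₗ[k] A) (F : List A → A) (ds : List ℤ) (a : List A) : A :=
  ∑ c : Composition a.length,
    gsign (wExp c.blocks + koszulExp (ds.splitWrtComposition c)) •
      dgOps d ((a.splitWrtComposition c).map F)

/-- The Stasheff morphism identity `Stᵐₙ` holds at every arity `n ≤ N`. -/
def SatisfiesStasheffMorph (d : A →ₗ[k] A) (𝒜 : ℤ → Submodule k A)
    (F M : List A → A) (N : ℕ) : Prop :=
  ∀ (ds : List ℤ) (a : List A), a.length ≤ N → IsCycleList d a →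
    IsHomogeneousList 𝒜 ds a → MorphismLHS F M ds a = MorphismRHS d F ds a

/-- The arity-`n` data was chosen according to the Kadeishvili algorithm (`n ≥ 3`):
`mₙ(a)` is the homology class of the cycle `Ψₙ(a)`, and `d fₙ(a) = Ψₙ(a) - f₁(mₙ(a))`. -/
def KadeishviliAt (d : A →ₗ[k] A) (𝒜 : ℤ → Submodule k A) (F M : List A → A)
    (n : ℕ) : Prop :=
  ∀ (ds : List ℤ) (a : List A), a.length = n → IsCycleList d a →
    IsHomogeneousList 𝒜 ds a →
      M a - Psi F M ds a ∈ LinearMap.range d ∧ d (F a) = Psi F M ds a - F [M a]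

/-- The arity-two map `f₂` was chosen according to the Kadeishvili algorithm:
`d f₂(a₁,a₂) = f₁(a₁)f₁(a₂) - f₁(a₁a₂)`. -/
def KadeishviliTwo (d : A →ₗ[k] A) (F : List A → A) : Prop :=
  ∀ u ∈ LinearMap.ker d, ∀ v ∈ LinearMap.ker d,
    d (F [u, v]) = F [u] * F [v] - F [u * v]

/-- `M` encodes `k[z]`-multilinear operations (up to arity `N`):
`mₙ(a₁,…,z·aᵢ,…,aₙ) = z·mₙ(a₁,…,aₙ)` on homology. -/
def OpsZLinear (d : A →ₗ[k] A) (z₀ : A) (M : List A → A) (N : ℕ) : Prop :=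
  ∀ (pre : List A) (u : A) (post : List A), pre.length + post.length + 1 ≤ N →
    IsCycleList d pre → u ∈ LinearMap.ker d → IsCycleList d post →
    M (pre ++ (z₀ * u) :: post) - z₀ * M (pre ++ u :: post) ∈ LinearMap.range d

/-- `F` encodes `k[z]`-multilinear maps (up to arity `N`):
`fₙ(a₁,…,z·aᵢ,…,aₙ) = f₁(z)·fₙ(a₁,…,aₙ)` in `A`. -/
def MapsZLinear (d : A →ₗ[k] A) (z₀ : A) (F : List A → A) (N : ℕ) : Prop :=
  ∀ (pre : List A) (u : A) (post : List A), pre.length + post.length + 1 ≤ N →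
    IsCycleList d pre → u ∈ LinearMap.ker d → IsCycleList d post →
    F (pre ++ (z₀ * u) :: post) = F [z₀] * F (pre ++ u :: post)

/-- `ζ = f₁(z)` commutes with all the values of `F` (up to arity `N`). -/
def ZetaCommutes (d : A →ₗ[k] A) (z₀ : A) (F : List A → A) (N : ℕ) : Prop :=
  ∀ a : List A, a.length ≤ N → IsCycleList d a → F [z₀] * F a = F a * F [z₀]

theorem gsign_congr {e e' : ℤ} (h : Even e ↔ Even e') : gsign e = gsign e' := by
  simp only [gsign, h]

theorem gsign_succ (e : ℤ) : gsign (e + 1) = -gsign e := by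
  by_cases h : Even e <;> simp [gsign, h]

theorem IsCycleList.take {d : A →ₗ[k] A} {a : List A} (h : IsCycleList d a) (s : ℕ) :
    IsCycleList d (a.take s) := fun x hx => h x (List.mem_of_mem_take hx)

theorem IsCycleList.drop {d : A →ₗ[k] A} {a : List A} (h : IsCycleList d a) (s : ℕ) :
    IsCycleList d (a.drop s) := fun x hx => h x (List.mem_of_mem_drop hx)

theorem IsCycleList.append {d : A →ₗ[k] A} {a b : List A} (ha : IsCycleList d a)
    (hb : IsCycleList d b) : IsCycleList d (a ++ b) := fun x hx =>
  (List.mem_append.1 hx).elim (ha x) (hb x)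

theorem IsCycleList.cons {d : A →ₗ[k] A} {x : A} {a : List A} (hx : x ∈ LinearMap.ker d)
    (ha : IsCycleList d a) : IsCycleList d (x :: a) := fun y hy =>
  (List.mem_cons.1 hy).elim (fun h => h ▸ hx) (ha y)

theorem IsCycleList.homologyEquiv_refl {d : A →ₗ[k] A} {a : List A} (h : IsCycleList d a) :
    HomologyEquiv d a a :=
  List.forall₂_same.2 fun x hx => ⟨h x hx, h x hx, by simp⟩

/-- A family on homology takes the same value after replacing one entry by a homologous one. -/
theorem EncodesFamily.eq_of_homologous {d : A →ₗ[k] A} {F : List A → A} {N : ℕ}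
    (hF : EncodesFamily d F N) {pre post : List A} {x y : A}
    (hN : pre.length + post.length + 1 ≤ N) (hpre : IsCycleList d pre)
    (hpost : IsCycleList d post) (hx : x ∈ LinearMap.ker d) (hy : y ∈ LinearMap.ker d)
    (hxy : x - y ∈ LinearMap.range d) :
    F (pre ++ x :: post) = F (pre ++ y :: post) :=
  hF.congr _ _ (by simpa [add_assoc] using hN)
    (List.rel_append hpre.homologyEquiv_refl
      (List.Forall₂.cons ⟨hx, hy, hxy⟩ hpost.homologyEquiv_refl))

/-- If `1` is the unit of a dg-algebra and `c • 1` is homologous to an element of nonzero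
degree, then `c • 1` is a boundary. -/
theorem IsDGAlgebra.smul_one_mem_range {𝒜 : ℤ → Submodule k A} [SetLike.GradedMonoid 𝒜]
    [DirectSum.Decomposition 𝒜] {d : A →ₗ[k] A} (hdg : IsDGAlgebra 𝒜 d) {p : ℤ} (hp : p ≠ 0)
    {x : A} (hx : x ∈ 𝒜 p) {c : k} (hxc : x - c • (1 : A) ∈ LinearMap.range d) :
    c • (1 : A) ∈ LinearMap.range d := by
  have hd : ∀ y : A, (DirectSum.decompose 𝒜 (d y) 0 : A) =
      d (DirectSum.decompose 𝒜 y (-1) : A) := by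
    intro y
    induction y using DirectSum.Decomposition.inductionOn 𝒜 with
    | zero => simp
    | @homogeneous q m =>
      by_cases hq : q = -1
      · subst hq
        rw [DirectSum.decompose_of_mem_same 𝒜 (by simpa using hdg.d_deg _ _ m.2 : d m ∈ 𝒜 0),
          DirectSum.decompose_of_mem_same 𝒜 m.2]
      · rw [DirectSum.decompose_of_mem_ne 𝒜 (hdg.d_deg _ _ m.2) (by omega),
          DirectSum.decompose_of_mem_ne 𝒜 m.2 hq, map_zero]
    | add u v hu hv => simp [hu, hv]
  obtain ⟨y, hy⟩ := hxc
  have h1 : c • (1 : A) ∈ 𝒜 0 := Submodule.smul_mem _ _ SetLike.GradedOne.one_mem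
  have h := hd y
  rw [hy, DirectSum.decompose_sub, DirectSum.sub_apply, AddSubgroupClass.coe_sub,
    DirectSum.decompose_of_mem_ne 𝒜 hx hp, DirectSum.decompose_of_mem_same 𝒜 h1] at h
  exact ⟨-(DirectSum.decompose 𝒜 y (-1) : A), by rw [map_neg, ← h]; simp⟩

/-- The products of values of `F` in `Ψₙ` when the entry `x` is a multiple of the unit. -/
theorem sum_mul_eq_of_unit {d : A →ₗ[k] A} {F : List A → A} {pre post : List A} {x : A} {c : k}
    (e : ℕ → ℤ) (hn : 3 ≤ pre.length + post.length + 1)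
    (hpre : IsCycleList d pre) (hpost : IsCycleList d post) (hFx : F [x] = c • (1 : A))
    (hF0 : ∀ p q : List A, IsCycleList d p → IsCycleList d q → 2 ≤ p.length + q.length + 1 →
      p.length + q.length + 1 ≤ pre.length + post.length → F (p ++ x :: q) = 0) :
    ∑ s ∈ Finset.Ioo 0 (pre.length + post.length + 1),
      gsign (e s) • (F ((pre ++ x :: post).take s) * F ((pre ++ x :: post).drop s)) =
    (if pre = [] then gsign (e 1) • c • F (pre ++ post) else 0) +
      (if post = [] then gsign (e (pre.length + post.length)) • c • F (pre ++ post) else 0) := by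
  have hterm : ∀ s ∈ Finset.Ioo 0 (pre.length + post.length + 1),
      gsign (e s) • (F ((pre ++ x :: post).take s) * F ((pre ++ x :: post).drop s)) =
      (if s = 1 then (if pre = [] then gsign (e 1) • c • F (pre ++ post) else 0) else 0) +
      (if s = pre.length + post.length then
        (if post = [] then gsign (e (pre.length + post.length)) • c • F (pre ++ post) else 0)
        else 0) := by
    intro s hs
    rw [Finset.mem_Ioo] at hs
    rcases le_or_gt s pre.length with h | h
    · rw [List.drop_append_of_le_length h, List.take_append_of_le_length h]
      by_cases hs' : s = pre.length + post.length
      · have hp : post = [] := List.eq_nil_of_length_eq_zero (by omega)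
        subst hp
        have : s = pre.length := by simpa using hs'
        subst this
        have hne : pre.length ≠ 1 := by simp at hn; omega
        simp [hFx, hne]
      · rw [hF0 _ _ (hpre.drop s) hpost (by simp; omega) (by simp; omega)]
        by_cases h1 : s = 1
        · have : pre ≠ [] := by rintro rfl; simp at h; omega
          simp [hs', this]
        · simp [hs', h1]
    · obtain ⟨m, rfl⟩ : ∃ m, s = pre.length + (m + 1) := ⟨s - pre.length - 1, by omega⟩
      rw [List.take_length_add_append, List.drop_length_add_append, List.take_succ_cons,
        List.drop_succ_cons]
      by_cases h1 : pre.length + (m + 1) = 1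
      · have hp : pre = [] := List.eq_nil_of_length_eq_zero (by omega)
        subst hp
        obtain rfl : m = 0 := by simpa using h1
        have hne : 1 ≠ post.length := by simp at hn; omega
        simp [hFx, hne]
      · rw [hF0 _ _ hpre (hpost.take m) (by simp; omega) (by simp; omega)]
        have hp : pre.length + (m + 1) = pre.length + post.length → post ≠ [] := by
          rintro h2 rfl
          simp at h2
        simp only [h1, if_false]
        split_ifs with h2 h3
        · exact absurd h3 (hp h2)
        all_goals simp
  rw [Finset.sum_congr rfl hterm, Finset.sum_add_distrib, Finset.sum_ite_eq',
    Finset.sum_ite_eq', if_pos (Finset.mem_Ioo.2 ⟨by omega, by omega⟩),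
    if_pos (Finset.mem_Ioo.2 ⟨by omega, by omega⟩)]

/-- The composition terms of `Ψₙ` when the entry `x` is a multiple of the unit. -/
theorem sum_comp_eq_of_unit {d : A →ₗ[k] A} {F M : List A → A} {pre post : List A} {x : A} {c : k}
    (e : ℕ → ℕ → ℤ) (hn : 3 ≤ pre.length + post.length + 1)
    (hpre : IsCycleList d pre) (hpost : IsCycleList d post) (hx : x ∈ LinearMap.ker d)
    (hM : EncodesOps d M (pre.length + post.length))
    (hF : EncodesFamily d F (pre.length + post.length))
    (hFrange : ∀ (p q : List A) (y : A), IsCycleList d p → IsCycleList d q →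
      2 ≤ p.length + q.length + 1 → p.length + q.length + 1 ≤ pre.length + post.length →
      y ∈ LinearMap.range d → F (p ++ y :: q) = 0)
    (hF0 : ∀ p q : List A, IsCycleList d p → IsCycleList d q → 2 ≤ p.length + q.length + 1 →
      p.length + q.length + 1 ≤ pre.length + post.length → F (p ++ x :: q) = 0)
    (hM0 : ∀ p q : List A, IsCycleList d p → IsCycleList d q → 3 ≤ p.length + q.length + 1 →
      p.length + q.length + 1 ≤ pre.length + post.length →
      M (p ++ x :: q) ∈ LinearMap.range d)
    (hMl : ∀ v ∈ LinearMap.ker d, M [x, v] - c • v ∈ LinearMap.range d)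
    (hMr : ∀ v ∈ LinearMap.ker d, M [v, x] - c • v ∈ LinearMap.range d) :
    ∑ j ∈ Finset.Icc 2 (pre.length + post.length),
      ∑ t ∈ Finset.Icc 0 (pre.length + post.length + 1 - j), gsign (e j t) •
        F ((pre ++ x :: post).take t ++ M (((pre ++ x :: post).drop t).take j) ::
          (pre ++ x :: post).drop (t + j)) =
    (if post = [] then 0 else gsign (e 2 pre.length) • c • F (pre ++ post)) +
      (if pre = [] then 0 else gsign (e 2 (pre.length - 1)) • c • F (pre ++ post)) := by
  have hall : IsCycleList d (pre ++ x :: post) := hpre.append (hpost.cons hx)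
  have hker : ∀ j t, j ≤ pre.length + post.length →
      M (((pre ++ x :: post).drop t).take j) ∈ LinearMap.ker d := fun j t hj =>
    hM.mem_ker _ ((List.length_take_le _ _).trans hj) ((hall.drop t).take j)
  -- the unit lies outside the inner operation
  have hout : ∀ j t, 2 ≤ j → t + j ≤ pre.length + post.length + 1 → j ≤ pre.length + post.length →
      (pre.length < t ∨ t + j ≤ pre.length) →
      F ((pre ++ x :: post).take t ++ M (((pre ++ x :: post).drop t).take j) ::
          (pre ++ x :: post).drop (t + j)) = 0 := by
    intro j t hj htj hjn h
    have hk := hker j t hjn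
    revert hk
    generalize M (((pre ++ x :: post).drop t).take j) = y
    intro hk
    rcases h with h | h
    · obtain ⟨m, rfl⟩ : ∃ m, t = pre.length + (m + 1) := ⟨t - pre.length - 1, by omega⟩
      rw [List.take_length_add_append, List.take_succ_cons, List.append_assoc, List.cons_append]
      refine hF0 _ _ hpre ((hpost.take m).append ((hall.drop _).cons hk)) ?_ ?_
      · simp; omega
      · simp; omega
    · rw [List.drop_append_of_le_length h, List.take_append_of_le_length (by omega),
        ← List.cons_append, ← List.append_assoc]
      refine hF0 _ _ ((hpre.take t).append ((hpre.drop _).cons hk)) hpost ?_ ?_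
      · simp; omega
      · simp; omega
  -- the unit lies inside an inner operation of arity at least three
  have hin : ∀ j t, 3 ≤ j → t + j ≤ pre.length + post.length + 1 → j ≤ pre.length + post.length →
      t ≤ pre.length → pre.length < t + j →
      F ((pre ++ x :: post).take t ++ M (((pre ++ x :: post).drop t).take j) ::
          (pre ++ x :: post).drop (t + j)) = 0 := by
    intro j t hj htj hjn h1 h2
    refine hFrange _ _ _ (hall.take t) (hall.drop _) ?_ ?_ ?_
    · simp; omega
    · simp; omega
    · obtain ⟨m, hm⟩ : ∃ m, j = (pre.drop t).length + (m + 1) :=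
        ⟨t + j - pre.length - 1, by simp; omega⟩
      rw [List.drop_append_of_le_length h1, hm, List.take_length_add_append, List.take_succ_cons]
      have hm' := hm
      rw [List.length_drop] at hm'
      refine hM0 _ _ (hpre.drop t) (hpost.take m) ?_ ?_
      · simp; omega
      · simp; omega
  -- a product with the unit contributes the list with the unit removed
  have hprod : ∀ (p q : List A) (y v : A), IsCycleList d p → IsCycleList d q →
      y ∈ LinearMap.ker d → v ∈ LinearMap.ker d →
      p.length + q.length + 1 ≤ pre.length + post.length → y - c • v ∈ LinearMap.range d →
      F (p ++ y :: q) = c • F (p ++ v :: q) := by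
    intro p q y v hp hq hy hv hN hyv
    rw [hF.eq_of_homologous hN hp hq hy (Submodule.smul_mem _ c hv) hyv,
      hF.map_smul _ _ _ _ hN hp hv hq]
  rw [Finset.sum_eq_single 2]
  · have hterm : ∀ t ∈ Finset.Icc 0 (pre.length + post.length + 1 - 2), gsign (e 2 t) •
        F ((pre ++ x :: post).take t ++ M (((pre ++ x :: post).drop t).take 2) ::
          (pre ++ x :: post).drop (t + 2)) =
        (if t = pre.length then
          (if post = [] then 0 else gsign (e 2 pre.length) • c • F (pre ++ post)) else 0) +
        (if t = pre.length - 1 then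
          (if pre = [] then 0 else gsign (e 2 (pre.length - 1)) • c • F (pre ++ post))
          else 0) := by
      intro t ht
      rw [Finset.mem_Icc] at ht
      by_cases h1 : t = pre.length
      · subst h1
        obtain ⟨v, q, rfl⟩ := List.exists_cons_of_length_pos (l := post) (by omega)
        have hv := hpost v (by simp)
        have hq : IsCycleList d q := fun z hz => hpost z (by simp [hz])
        have hy := hker 2 pre.length (by omega)
        have hz : (if pre.length = pre.length - 1 then
          (if pre = [] then (0 : A) else
            gsign (e 2 (pre.length - 1)) • c • F (pre ++ v :: q)) else 0) = 0 := by
          rcases pre with _ | ⟨u, p⟩ <;> simp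
        rw [hz]
        simp only [List.take_left', List.drop_left', List.drop_length_add_append,
          List.take_succ_cons, List.take_zero, List.drop_succ_cons, List.drop_zero,
          if_true, reduceCtorEq, if_false, add_zero] at hy ⊢
        rw [hprod _ _ _ v hpre hq hy hv (by simp) (hMl v hv)]
      · by_cases h2 : t + 1 = pre.length
        · obtain ⟨p, v, rfl⟩ : ∃ p v, pre = p ++ [v] := by
            rcases List.eq_nil_or_concat pre with h | ⟨p, v, h⟩
            · simp [h] at h2
            · exact ⟨p, v, by simpa using h⟩
          obtain rfl : t = p.length := by simpa using h2
          have hv := hpre v (by simp)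
          have hp : IsCycleList d p := fun z hz => hpre z (by simp [hz])
          have hy := hker 2 p.length (by omega)
          simp only [List.append_assoc, List.cons_append, List.nil_append, List.take_left',
            List.drop_left', List.drop_length_add_append,
            List.take_succ_cons, List.take_zero, List.drop_succ_cons, List.drop_zero] at hy ⊢
          rw [hprod _ _ _ v hp hpost hy hv (by simp) (hMr v hv)]
          simp
        · rw [hout 2 t le_rfl (by omega) (by omega) (by omega)]
          have h3 : t ≠ pre.length - 1 := by omega
          simp [h1, h3]
    rw [Finset.sum_congr rfl hterm, Finset.sum_add_distrib, Finset.sum_ite_eq',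
      Finset.sum_ite_eq']
    congr 1
    · by_cases hp : post = []
      · simp [hp]
      · have := List.length_pos_iff.2 hp
        rw [if_pos (Finset.mem_Icc.2 ⟨by omega, by omega⟩)]
    · rw [if_pos (Finset.mem_Icc.2 ⟨by omega, by omega⟩)]
  · intro j hj hj2
    rw [Finset.mem_Icc] at hj
    refine Finset.sum_eq_zero fun t ht => ?_
    rw [Finset.mem_Icc] at ht
    by_cases h : pre.length < t ∨ t + j ≤ pre.length
    · rw [hout j t hj.1 (by omega) hj.2 h, smul_zero]
    · rw [hin j t (by omega) (by omega) hj.2 (by omega) (by omega), smul_zero]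
  · intro h
    exact absurd (Finset.mem_Icc.2 ⟨le_rfl, by omega⟩) h

/-- Let `A` be a unital dg-algebra (the unit is a cycle of degree
zero). Suppose `m₁ = 0`, `m₂` is the induced multiplication, `f₁` is cycle-choosing
with `f₁(1) = 1`, each `f_k` (`2 ≤ k ≤ n-1`) vanishes whenever one argument is a
scalar multiple of the unit class, and each `m_k` (`3 ≤ k ≤ n-1`) vanishes whenever
one argument is a scalar multiple of the unit class. Then `Ψₙ(a₁,…,aₙ) = 0`
whenever some argument `aᵢ` is (the class of) `c • 1`. -/
theorem stmt3 (𝒜 : ℤ → Submodule k A) [SetLike.GradedMonoid 𝒜]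
    [DirectSum.Decomposition 𝒜]
    (d : A →ₗ[k] A) (hdg : IsDGAlgebra 𝒜 d) (hone : d 1 = 0)
    (n : ℕ) (hn : 3 ≤ n)
    (M F : List A → A)
    (hM : EncodesOps d M (n - 1)) (hF : EncodesFamily d F (n - 1))
    (hf1 : IsCycleChoosing d F) (hFone : F [(1 : A)] = 1)
    (hm1 : MOneZero d M) (hm2 : MTwoInduced d M)
    (hFunit : ∀ (pre post : List A) (c : k), 2 ≤ pre.length + post.length + 1 →
      pre.length + post.length + 1 ≤ n - 1 → IsCycleList d pre → IsCycleList d post →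
      F (pre ++ (c • (1 : A)) :: post) = 0)
    (hMunit : ∀ (pre post : List A) (c : k), 3 ≤ pre.length + post.length + 1 →
      pre.length + post.length + 1 ≤ n - 1 → IsCycleList d pre → IsCycleList d post →
      M (pre ++ (c • (1 : A)) :: post) ∈ LinearMap.range d) :
    ∀ (ds : List ℤ) (a : List A) (i : ℕ) (hi : i < a.length) (c : k),
      a.length = n → IsCycleList d a → IsHomogeneousList 𝒜 ds a →
      a.get ⟨i, hi⟩ - c • (1 : A) ∈ LinearMap.range d →
      Psi F M ds a = 0 := by
  intro ds a i hi c hlen ha hds hac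
  obtain ⟨pre, x, post, rfl, hx0⟩ : ∃ pre x post, a = pre ++ x :: post ∧ a.get ⟨i, hi⟩ = x :=
    ⟨a.take i, a[i], a.drop (i + 1), by simp, rfl⟩
  rw [hx0] at hac
  clear hx0 hi
  have hlen' : (pre ++ x :: post).length = pre.length + post.length + 1 := by simp [add_assoc]
  obtain rfl : n = pre.length + post.length + 1 := by omega
  simp only [add_tsub_cancel_right] at hM hF hFunit hMunit
  have hpre : IsCycleList d pre := fun z hz => ha z (by simp [hz])
  have hpost : IsCycleList d post := fun z hz => ha z (by simp [hz])
  have hx : x ∈ LinearMap.ker d := ha x (by simp)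
  have h1 : (1 : A) ∈ LinearMap.ker d := hone
  have hc1 : ∀ b : k, b • (1 : A) ∈ LinearMap.ker d := fun b => Submodule.smul_mem _ b h1
  have hnil : IsCycleList d [] := fun z hz => by simp at hz
  have hFs : ∀ b : k, F [b • (1 : A)] = b • (1 : A) := fun b => by
    simpa [hFone] using hF.map_smul [] b 1 [] (by simp; omega) hnil h1 hnil
  have hFhom : ∀ y z : A, y ∈ LinearMap.ker d → z ∈ LinearMap.ker d →
      y - z ∈ LinearMap.range d → F [y] = F [z] := fun y z hy hz hyz =>
    hF.eq_of_homologous (pre := []) (by simp; omega) hnil hnil hy hz hyz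
  have hF0 : ∀ (p q : List A) (y : A) (b : k), IsCycleList d p → IsCycleList d q →
      2 ≤ p.length + q.length + 1 → p.length + q.length + 1 ≤ pre.length + post.length →
      y ∈ LinearMap.ker d → y - b • (1 : A) ∈ LinearMap.range d → F (p ++ y :: q) = 0 :=
    fun p q y b hp hq h2 hN hy hyb => by
      rw [hF.eq_of_homologous hN hp hq hy (hc1 b) hyb, hFunit p q b h2 hN hp hq]
  have hrk : ∀ y ∈ LinearMap.range d, y ∈ LinearMap.ker d := by
    rintro _ ⟨z, rfl⟩
    exact hdg.d_sq z
  have hMs : ∀ v ∈ LinearMap.ker d, M [x, v] - c • v ∈ LinearMap.range d := by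
    intro v hv
    have h := hM.eq_of_homologous (pre := []) (post := [v]) (by simp; omega) hnil
      (hnil.cons hv) hx (hc1 c) hac
    simp only [List.nil_append] at h
    rw [h]
    simpa using hm2 _ (hc1 c) v hv
  have hMs' : ∀ v ∈ LinearMap.ker d, M [v, x] - c • v ∈ LinearMap.range d := by
    intro v hv
    have h := hM.eq_of_homologous (pre := [v]) (post := []) (by simp; omega)
      (hnil.cons hv) hnil hx (hc1 c) hac
    simp only [List.cons_append, List.nil_append] at h
    rw [h]
    simpa using hm2 v hv _ (hc1 c)
  unfold Psi
  rw [hlen']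
  rw [sum_mul_eq_of_unit (c := c)
      (fun s => (s : ℤ) + (((pre.length + post.length + 1 : ℕ) : ℤ) - (s : ℤ) + 1) *
        (ds.take s).sum) hn hpre hpost (by rw [hFhom x _ hx (hc1 c) hac, hFs])
      (fun p q hp hq h2 hN => hF0 p q x c hp hq h2 hN hx hac),
    add_tsub_cancel_right,
    sum_comp_eq_of_unit (c := c)
      (fun j t => (t : ℤ) + (j : ℤ) * (((pre.length + post.length + 1 : ℕ) : ℤ) - (t : ℤ) -
        (j : ℤ) + (ds.take t).sum)) hn hpre hpost hx hM hF
      (fun p q y hp hq h2 hN hy => hF0 p q y 0 hp hq h2 hN (hrk y hy) (by simpa using hy))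
      (fun p q hp hq h2 hN => hF0 p q x c hp hq h2 hN hx hac)
      (fun p q hp hq h3 hN => by
        rw [hM.eq_of_homologous hN hp hq hx (hc1 c) hac]
        exact hMunit p q c h3 hN hp hq)
      hMs hMs']
  have hdeg : pre = [] → (ds.take 1).sum = 0 ∨ ∀ y : A, c • y = 0 := by
    rintro rfl
    rcases hds with _ | ⟨hp, -⟩
    rename_i p ds'
    by_cases hp0 : p = 0
    · exact Or.inl (by simp [hp0])
    · have hr := hdg.smul_one_mem_range hp0 hp hac
      have h0 : c • (1 : A) = 0 := by
        have := hFhom _ ((0 : k) • (1 : A)) (hc1 c) (hc1 0) (by simpa using hr)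
        rwa [hFs, hFs, zero_smul] at this
      exact Or.inr fun y => by rw [← one_mul y, ← smul_mul_assoc, h0, zero_mul]
  have hpar : ∀ (m l : ℤ), gsign (m + 2 * l) = gsign m := fun m l =>
    gsign_congr (by simp [Int.even_add])
  by_cases hp : pre = []
  · subst hp
    have hq : post ≠ [] := by rintro rfl; simp at hn
    simp only [if_true, hq, if_false]
    rcases hdeg rfl with h | h
    · simp [h, gsign]
    · simp [h]
  · obtain ⟨l, hl⟩ : ∃ l, pre.length = l + 1 :=
      ⟨pre.length - 1, by have := List.length_pos_iff.2 hp; omega⟩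
    by_cases hq : post = []
    · subst hq
      simp only [hp, if_true, if_false, hl, List.length_nil, add_zero, add_tsub_cancel_right,
        Nat.cast_add, Nat.cast_one, Nat.cast_ofNat, zero_add]
      rw [show ((l : ℤ) + 1 + 1 - (l + 1) + 1) = 2 by ring, hpar, hpar, gsign_succ]
      simp
    · simp only [hp, hq, if_false, hl, add_tsub_cancel_right, Nat.cast_add, Nat.cast_one,
        Nat.cast_ofNat, hpar, gsign_succ]
      simp
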